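/- Let A ⊆ B be a (φ,ψ)-bounded extension of the multi-filtered K-algebra A with φ injective. Then B is a free left A-module with basis the standard monomials { x^α : α ∈ ℕ^s } if and only if the homomorphism f : G(A) → G(B) is injective and G(B), regarded as a left G(A)-module via f, is free with basis { y^α : α ∈ ℕ^s }. -/

import Mathlib

open scoped BigOperators

/-- Multi-indices: elements of `ℕ^n`. -/
abbrev MIdx (n : ℕ) := Fin n → ℕ

/-- An admissible order on `ℕ^n`: a total order compatible with addition and having `0` as
least element. -/
structure AdmOrder (n : ℕ) where
  le : MIdx n → MIdx n → Prop
  le_refl : ∀ a, le a a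
  le_trans : ∀ {a b c}, le a b → le b c → le a c
  le_antisymm : ∀ {a b}, le a b → le b a → a = b
  le_total : ∀ a b, le a b ∨ le b a
  add_right : ∀ {a b : MIdx n} (c : MIdx n), le a b → le (a + c) (b + c)
  zero_le : ∀ a, le 0 a

/-- The strict order associated to an admissible order. -/
def AdmOrder.lt {n : ℕ} (o : AdmOrder n) (a b : MIdx n) : Prop :=
  o.le a b ∧ a ≠ b

/-- The ordered standard monomial `x^β = x₁^{β₁} ⋯ x_s^{β_s}`. -/
def smon {B : Type*} [Monoid B] {s : ℕ} (x : Fin s → B) (β : MIdx s) : B :=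
  (List.ofFn fun i => x i ^ β i).prod

/-- The `K`-submodule `Σ_{γ with P γ} F_{γ₁}(A)·x^{γ₂}` of `B`. -/
def monSum (K : Type*) [CommRing K] (B : Type*) [Ring B] [Algebra K B]
    {m s : ℕ} (F : MIdx m → Submodule K B) (x : Fin s → B)
    (P : MIdx m × MIdx s → Prop) : Submodule K B :=
  ⨆ γ ∈ {γ : MIdx m × MIdx s | P γ},
    (F γ.1).map (LinearMap.mulRight K (smon x γ.2))

/-- A `(φ,ψ)`-bounded extension `A ⊆ B` of a multi-filtered `K`-algebra `A`, where `A` is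
realized as a subalgebra of `B` carrying an `(ℕ^m,⪯₁)`-filtration `F`, and `B` is generated
over `A` by elements `x 1, …, x s`, subject to the axioms (EA1)–(EA4). -/
structure BoundedExt (K : Type*) [CommRing K] (B : Type*) [Ring B] [Algebra K B]
    (m s n : ℕ) where
  /-- admissible order `⪯₁` on `ℕ^m` -/
  o1 : AdmOrder m
  /-- admissible order `⪯₂` on `ℕ^s` -/
  o2 : AdmOrder s
  /-- admissible order `⪯` on `ℕ^n` -/
  o : AdmOrder n
  /-- the monoid morphism `φ : ℕ^m → ℕ^n` -/
  φ : MIdx m →+ MIdx n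
  /-- the monoid morphism `ψ : ℕ^s → ℕ^n` -/
  ψ : MIdx s →+ MIdx n
  φ_mono : ∀ {a b : MIdx m}, o1.le a b → o.le (φ a) (φ b)
  ψ_mono : ∀ {a b : MIdx s}, o2.le a b → o.le (ψ a) (ψ b)
  /-- the subalgebra `A` of `B` -/
  A : Subalgebra K B
  /-- (EA1): the `(ℕ^m,⪯₁)`-filtration on `A` -/
  F : MIdx m → Submodule K B
  F_le_A : ∀ a : MIdx m, F a ≤ Subalgebra.toSubmodule A
  F_mono : ∀ {a b : MIdx m}, o1.le a b → F a ≤ F b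
  F_mul : ∀ {a b : MIdx m} {u v : B}, u ∈ F a → v ∈ F b → u * v ∈ F (a + b)
  F_exhaustive : ∀ u ∈ A, ∃ a : MIdx m, u ∈ F a
  F_one : (1 : B) ∈ F 0
  /-- the generators `x_1, …, x_s` -/
  x : Fin s → B
  /-- (EA2): `B` is generated as a `K`-algebra by `A` and `x_1, …, x_s` -/
  gen : Algebra.adjoin K ((A : Set B) ∪ Set.range x) = ⊤
  /-- (EA3) -/
  EA3 : ∀ (i : Fin s) (α : MIdx m), ∀ a ∈ F α,
    x i * a ∈ (F α).map (LinearMap.mulRight K (x i)) ⊔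
      monSum K B F x (fun γ => o.lt (φ γ.1 + ψ γ.2) (φ α + ψ (Pi.single i 1)))
  /-- (EA4) -/
  EA4 : ∀ i j : Fin s, i < j → ∃ q ∈ F 0,
    x j * x i - q * (x i * x j) ∈
      monSum K B F x (fun γ => o.lt (φ γ.1 + ψ γ.2) (ψ (Pi.single i 1 + Pi.single j 1)))

namespace BoundedExt

variable {K : Type*} [CommRing K] {B : Type*} [Ring B] [Algebra K B] {m s n : ℕ}

/-- The weight `wt(γ) = φ(γ₁) + ψ(γ₂)` of a pair of multi-indices. -/
def wt (E : BoundedExt K B m s n) (γ : MIdx m × MIdx s) : MIdx n :=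
  E.φ γ.1 + E.ψ γ.2

/-- The filtration `F̃_α(B) = Σ_{wt(γ) ⪯ α} F_{γ₁}(A)x^{γ₂}` on `B`. -/
def tF (E : BoundedExt K B m s n) (α : MIdx n) : Submodule K B :=
  monSum K B E.F E.x (fun γ => E.o.le (E.wt γ) α)

/-- `F̃_{≺α}(B) = ⋃_{β ≺ α} F̃_β(B)`. -/
def tFlt (E : BoundedExt K B m s n) (α : MIdx n) : Submodule K B :=
  ⨆ β ∈ {β : MIdx n | E.o.lt β α}, E.tF β

/-- `F_{≺α}(A) = ⋃_{β ≺₁ α} F_β(A)`. -/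
def Flt (E : BoundedExt K B m s n) (α : MIdx m) : Submodule K B :=
  ⨆ β ∈ {β : MIdx m | E.o1.lt β α}, E.F β

/-- The strict order `≺'` on `ℕ^s × ℕ^n`: `(λ,ν) ≺' (λ',ν')` iff `ν ≺ ν'`, or `ν = ν'`
and `λ ≺₂ λ'`. -/
def ltP (E : BoundedExt K B m s n) (p q : MIdx s × MIdx n) : Prop :=
  E.o.lt p.2 q.2 ∨ (p.2 = q.2 ∧ E.o2.lt p.1 q.1)

end BoundedExt

namespace AdmOrder

variable {n : ℕ} (o : AdmOrder n)

theorem lt_iff_not_le {a b : MIdx n} : o.lt a b ↔ ¬ o.le b a := by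
  constructor
  · rintro ⟨h, hne⟩ h'
    exact hne (o.le_antisymm h h')
  · intro h
    refine ⟨(o.le_total a b).resolve_right h, ?_⟩
    rintro rfl
    exact h (o.le_refl _)

theorem lt_of_lt_of_le {a b c : MIdx n} (h : o.lt a b) (h' : o.le b c) : o.lt a c := by
  rw [lt_iff_not_le] at h ⊢
  exact fun hc => h (o.le_trans h' hc)

theorem lt_of_le_of_lt {a b c : MIdx n} (h : o.le a b) (h' : o.lt b c) : o.lt a c := by
  rw [lt_iff_not_le] at h' ⊢
  exact fun hc => h' (o.le_trans hc h)

theorem add_left {a b : MIdx n} (c : MIdx n) (h : o.le a b) : o.le (c + a) (c + b) := by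
  rw [add_comm c a, add_comm c b]
  exact o.add_right c h

theorem lt_add_right {a b : MIdx n} (c : MIdx n) (h : o.lt a b) : o.lt (a + c) (b + c) :=
  ⟨o.add_right c h.1, fun he => h.2 (add_right_cancel he)⟩

theorem lt_add_left {a b : MIdx n} (c : MIdx n) (h : o.lt a b) : o.lt (c + a) (c + b) :=
  ⟨o.add_left c h.1, fun he => h.2 (add_left_cancel he)⟩

theorem le_add_left (a c : MIdx n) : o.le a (c + a) := by
  simpa using o.add_right a (o.zero_le c)

theorem le_of_le {a b : MIdx n} (h : a ≤ b) : o.le a b := by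
  obtain ⟨c, rfl⟩ := exists_add_of_le h
  rw [add_comm]
  exact o.le_add_left a c

/-- Admissible orders are well-founded, by Dickson's lemma. -/
theorem wellFounded_lt : WellFounded o.lt := by
  rw [wellFounded_iff_isEmpty_descending_chain]
  refine ⟨fun ⟨f, hf⟩ => ?_⟩
  obtain ⟨i, j, hij, hle⟩ := wellQuasiOrdered_le (α := MIdx n) f
  have key : ∀ k, o.lt (f (i + k + 1)) (f i) := by
    intro k
    induction k with
    | zero => exact hf i
    | succ k ih => exact o.lt_of_le_of_lt (hf (i + k + 1)).1 ih
  have h := key (j - i - 1)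
  rw [show i + (j - i - 1) + 1 = j by omega, lt_iff_not_le] at h
  exact h (o.le_of_le hle)

end AdmOrder

theorem smon_zero {B : Type*} [Monoid B] {s : ℕ} (x : Fin s → B) : smon x 0 = 1 := by
  simp [smon]

theorem smon_succ {B : Type*} [Monoid B] {s : ℕ} (x : Fin (s + 1) → B) (β : MIdx (s + 1)) :
    smon x β = x 0 ^ β 0 * smon (fun i => x i.succ) (fun i => β i.succ) := by
  simp [smon, List.ofFn_succ]

theorem mul_smon {B : Type*} [Monoid B] {s : ℕ} (x : Fin s → B) (β : MIdx s) (i : Fin s)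
    (h : ∀ j < i, β j = 0) : x i * smon x β = smon x (β + Pi.single i 1) := by
  induction s with
  | zero => exact i.elim0
  | succ s ih =>
    rw [smon_succ, smon_succ]
    induction i using Fin.cases with
    | zero => simp [pow_succ', mul_assoc]
    | succ k =>
      have h0 : β 0 = 0 := h 0 (Fin.succ_pos k)
      have := ih (fun i => x i.succ) (fun i => β i.succ) k
        (fun j hj => h j.succ (Fin.succ_lt_succ_iff.2 hj))
      have he : (fun i : Fin s => (β + Pi.single k.succ 1 : MIdx (s + 1)) i.succ)
          = (fun i => β i.succ) + Pi.single k 1 := by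
        funext i
        simp [Pi.single_apply]
      rw [he, ← this]
      simp [h0]

theorem smon_single {B : Type*} [Monoid B] {s : ℕ} (x : Fin s → B) (i : Fin s) :
    smon x (Pi.single i 1) = x i := by
  have := mul_smon x 0 i (by simp)
  rw [smon_zero, mul_one, zero_add] at this
  exact this.symm

/-- A nonzero multi-index can be decreased at its first nonzero entry. -/
theorem MIdx.exists_eq_add_single {s : ℕ} (β : MIdx s) (i : Fin s) (hi : β i ≠ 0) :
    ∃ (j : Fin s) (β' : MIdx s), j ≤ i ∧ β = β' + Pi.single j 1 ∧ ∀ k < j, β k = 0 := by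
  obtain ⟨j, hj, hmin⟩ := (wellFounded_lt (α := Fin s)).has_min {j | β j ≠ 0} ⟨i, hi⟩
  refine ⟨j, β - Pi.single j 1, not_lt.1 (hmin i hi), ?_, fun k hk => ?_⟩
  · funext k
    rcases eq_or_ne k j with rfl | hkj
    · have : β k ≠ 0 := hj
      simp
      omega
    · simp [hkj]
  · by_contra h
    exact hmin k h hk

section monSum

variable {K : Type*} [CommRing K] {B : Type*} [Ring B] [Algebra K B] {m s : ℕ}
  {F : MIdx m → Submodule K B} {x : Fin s → B} {P Q : MIdx m × MIdx s → Prop}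

theorem mul_smon_mem_monSum {γ : MIdx m × MIdx s} (hγ : P γ) {a : B} (ha : a ∈ F γ.1) :
    a * smon x γ.2 ∈ monSum K B F x P :=
  Submodule.mem_iSup_of_mem γ (Submodule.mem_iSup_of_mem hγ ⟨a, ha, rfl⟩)

theorem monSum_le {N : Submodule K B} :
    monSum K B F x P ≤ N ↔ ∀ γ, P γ → ∀ a ∈ F γ.1, a * smon x γ.2 ∈ N := by
  simp only [monSum, iSup_le_iff, Submodule.map_le_iff_le_comap]
  rfl

theorem monSum_mono (h : ∀ γ, P γ → Q γ) : monSum K B F x P ≤ monSum K B F x Q :=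
  monSum_le.2 fun γ hγ _ ha => mul_smon_mem_monSum (h γ hγ) ha

theorem exists_finsupp_of_mem_monSum {b : B} (hb : b ∈ monSum K B F x P) :
    ∃ c : (MIdx m × MIdx s) →₀ B, (∀ γ, c γ ∈ F γ.1) ∧ (∀ γ ∈ c.support, P γ) ∧
      b = c.sum fun γ a => a * smon x γ.2 := by
  classical
  let N : Submodule K B :=
    { carrier := {b | ∃ c : (MIdx m × MIdx s) →₀ B, (∀ γ, c γ ∈ F γ.1) ∧
        (∀ γ ∈ c.support, P γ) ∧ b = c.sum fun γ a => a * smon x γ.2}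
      zero_mem' := ⟨0, by simp, by simp, by simp⟩
      add_mem' := by
        rintro _ _ ⟨c, hc, hP, rfl⟩ ⟨d, hd, hQ, rfl⟩
        refine ⟨c + d, fun γ => add_mem (hc γ) (hd γ), fun γ hγ => ?_, ?_⟩
        · rcases Finset.mem_union.1 (Finsupp.support_add hγ) with h | h
          exacts [hP γ h, hQ γ h]
        · rw [Finsupp.sum_add_index' (by simp) (by simp [add_mul])]
      smul_mem' := by
        rintro k _ ⟨c, hc, hP, rfl⟩
        refine ⟨k • c, fun γ => Submodule.smul_mem _ k (hc γ),
          fun γ hγ => hP γ (Finsupp.support_smul hγ), ?_⟩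
        rw [Finsupp.sum_smul_index' (by simp), Finsupp.smul_sum]
        simp }
  have hle : monSum K B F x P ≤ N := by
    refine monSum_le.2 fun γ hγ a ha => ⟨Finsupp.single γ a, fun δ => ?_, fun δ hδ => ?_, ?_⟩
    · rw [Finsupp.single_apply]
      split_ifs with h
      · exact h ▸ ha
      · exact zero_mem _
    · rw [Finset.mem_singleton.1 (Finsupp.support_single_subset hδ)]
      exact hγ
    · simp
  exact hle hb

theorem finsupp_sum_mem_monSum {c : (MIdx m × MIdx s) →₀ B} (hc : ∀ γ, c γ ∈ F γ.1)
    (hP : ∀ γ ∈ c.support, P γ) :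
    (c.sum fun γ a => a * smon x γ.2) ∈ monSum K B F x P :=
  sum_mem fun γ hγ => mul_smon_mem_monSum (hP γ hγ) (hc γ)

end monSum

namespace BoundedExt

variable {K : Type*} [CommRing K] {B : Type*} [Ring B] [Algebra K B] {m s n : ℕ}
  (E : BoundedExt K B m s n)

theorem tF_mono {α β : MIdx n} (h : E.o.le α β) : E.tF α ≤ E.tF β :=
  monSum_mono fun _ hγ => E.o.le_trans hγ h

theorem mul_smon_mem_tF (γ : MIdx m × MIdx s) {a : B} (ha : a ∈ E.F γ.1) :
    a * smon E.x γ.2 ∈ E.tF (E.wt γ) :=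
  mul_smon_mem_monSum (P := fun δ => E.o.le (E.wt δ) (E.wt γ)) (E.o.le_refl _) ha

theorem smon_mem_tF (β : MIdx s) : smon E.x β ∈ E.tF (E.ψ β) := by
  simpa [wt] using E.mul_smon_mem_tF (0, β) E.F_one

theorem x_mem_tF (i : Fin s) : E.x i ∈ E.tF (E.ψ (Pi.single i 1)) := by
  simpa only [smon_single] using E.smon_mem_tF (Pi.single i 1)

theorem F_le_tF (α : MIdx m) : E.F α ≤ E.tF (E.φ α) := fun a ha => by
  simpa [wt, smon_zero] using E.mul_smon_mem_tF (α, 0) ha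

theorem tF_le_tFlt {α β : MIdx n} (h : E.o.lt β α) : E.tF β ≤ E.tFlt α :=
  fun _ hb => Submodule.mem_iSup_of_mem β (Submodule.mem_iSup_of_mem h hb)

theorem tFlt_eq (α : MIdx n) :
    E.tFlt α = monSum K B E.F E.x fun γ => E.o.lt (E.wt γ) α := by
  apply le_antisymm
  · exact iSup₂_le fun β hβ => monSum_mono fun γ hγ => E.o.lt_of_le_of_lt hγ hβ
  · exact monSum_le.2 fun γ hγ a ha => E.tF_le_tFlt hγ (E.mul_smon_mem_tF γ ha)

theorem tFlt_le_tF (α : MIdx n) : E.tFlt α ≤ E.tF α :=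
  iSup₂_le fun _ hβ => E.tF_mono hβ.1

theorem tF_eq_sup (α : MIdx n) :
    E.tF α = monSum K B E.F E.x (fun γ => E.wt γ = α) ⊔ E.tFlt α := by
  apply le_antisymm
  · refine monSum_le.2 fun γ hγ a ha => ?_
    by_cases h : E.wt γ = α
    · exact Submodule.mem_sup_left (mul_smon_mem_monSum h ha)
    · exact Submodule.mem_sup_right (E.tF_le_tFlt ⟨hγ, h⟩ (E.mul_smon_mem_tF γ ha))
  · refine sup_le (monSum_mono fun γ hγ => ?_) (E.tFlt_le_tF α)
    rw [hγ]
    exact E.o.le_refl _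

theorem F_mul_tF {α : MIdx m} {u : MIdx n} {a b : B} (ha : a ∈ E.F α) (hb : b ∈ E.tF u) :
    a * b ∈ E.tF (E.φ α + u) := by
  have h : E.tF u ≤ (E.tF (E.φ α + u)).comap (LinearMap.mulLeft K a) := by
    refine monSum_le.2 fun γ hγ c hc => ?_
    have := E.mul_smon_mem_tF (α + γ.1, γ.2) (E.F_mul ha hc)
    rw [mul_assoc] at this
    refine E.tF_mono ?_ this
    have he : E.wt (α + γ.1, γ.2) = E.φ α + E.wt γ := by simp [wt, add_assoc]
    rw [he]
    exact E.o.add_left _ hγ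
  exact h hb

theorem F_mul_tFlt {α : MIdx m} {u : MIdx n} {a b : B} (ha : a ∈ E.F α) (hb : b ∈ E.tFlt u) :
    a * b ∈ E.tFlt (E.φ α + u) := by
  have h : E.tFlt u ≤ (E.tFlt (E.φ α + u)).comap (LinearMap.mulLeft K a) :=
    iSup₂_le fun v hv b hb => E.tF_le_tFlt (E.o.lt_add_left _ hv) (E.F_mul_tF ha hb)
  exact h hb

theorem exists_x_mul_sub_mem (i : Fin s) {α : MIdx m} {a : B} (ha : a ∈ E.F α) :
    ∃ a' ∈ E.F α, E.x i * a - a' * E.x i ∈ E.tFlt (E.φ α + E.ψ (Pi.single i 1)) := by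
  obtain ⟨_, ⟨a', ha', rfl⟩, r, hr, he⟩ := Submodule.mem_sup.1 (E.EA3 i α a ha)
  refine ⟨a', ha', ?_⟩
  rw [tFlt_eq, ← he]
  simpa [wt] using hr

theorem exists_x_mul_x_sub_mem {i j : Fin s} (hij : i < j) :
    ∃ q ∈ E.F 0, E.x j * E.x i - q * (E.x i * E.x j) ∈
      E.tFlt (E.ψ (Pi.single i 1 + Pi.single j 1)) := by
  simp only [tFlt_eq]
  exact E.EA4 i j hij

/-- Multiplicativity of the filtration `tF` in total weight strictly below `w`. -/
def MulBelow (w : MIdx n) : Prop :=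
  ∀ u v, E.o.lt (u + v) w → ∀ a ∈ E.tF u, ∀ b ∈ E.tF v, a * b ∈ E.tF (u + v)

variable {E}

theorem MulBelow.tFlt_mul {w u v : MIdx n} (hw : E.MulBelow w) (huv : E.o.le (u + v) w)
    {a b : B} (ha : a ∈ E.tFlt u) (hb : b ∈ E.tF v) : a * b ∈ E.tFlt (u + v) := by
  have h : E.tFlt u ≤ (E.tFlt (u + v)).comap (LinearMap.mulRight K b) :=
    iSup₂_le fun u' hu' a ha => E.tF_le_tFlt (E.o.lt_add_right v hu')
      (hw u' v (E.o.lt_of_lt_of_le (E.o.lt_add_right v hu') huv) a ha b hb)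
  exact h ha

theorem MulBelow.mul_tFlt {w u v : MIdx n} (hw : E.MulBelow w) (huv : E.o.le (u + v) w)
    {a b : B} (ha : a ∈ E.tF u) (hb : b ∈ E.tFlt v) : a * b ∈ E.tFlt (u + v) := by
  have h : E.tFlt v ≤ (E.tFlt (u + v)).comap (LinearMap.mulLeft K a) :=
    iSup₂_le fun v' hv' b hb => E.tF_le_tFlt (E.o.lt_add_left u hv')
      (hw u v' (E.o.lt_of_lt_of_le (E.o.lt_add_left u hv') huv) a ha b hb)
  exact h hb

theorem MulBelow.exists_x_mul_smon_sub_mem {w : MIdx n} (hw : E.MulBelow w) (i : Fin s)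
    (β : MIdx s) (hβ : E.o.le (E.ψ (β + Pi.single i 1)) w) :
    ∃ q ∈ E.F 0, E.x i * smon E.x β - q * smon E.x (β + Pi.single i 1) ∈
      E.tFlt (E.ψ (β + Pi.single i 1)) := by
  induction hN : ∑ k, β k generalizing β with
  | zero =>
    refine ⟨1, E.F_one, ?_⟩
    rw [mul_smon, one_mul, sub_self]
    · exact zero_mem _
    · intro j _
      exact Finset.sum_eq_zero_iff.1 hN j (Finset.mem_univ j)
  | succ N ih =>
    by_cases h0 : ∀ j < i, β j = 0
    · refine ⟨1, E.F_one, ?_⟩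
      rw [mul_smon _ _ _ h0, one_mul, sub_self]
      exact zero_mem _
    push Not at h0
    obtain ⟨j₀, hj₀, hβ₀⟩ := h0
    obtain ⟨j, β', hj, rfl, hmin⟩ := MIdx.exists_eq_add_single β j₀ hβ₀
    have hji : j < i := lt_of_le_of_lt hj hj₀
    have hmin' : ∀ k < j, β' k = 0 := fun k hk => by
      have := hmin k hk
      simp only [Pi.add_apply] at this
      omega
    have hadd : β' + Pi.single j 1 + Pi.single i 1 = β' + Pi.single i 1 + Pi.single j 1 := by
      rw [add_right_comm]
    have hle : E.o.le (E.ψ (β' + Pi.single i 1)) w := by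
      refine E.o.le_trans ?_ hβ
      rw [hadd, map_add _ (β' + Pi.single i 1), add_comm (E.ψ _)]
      exact E.o.le_add_left _ _
    have hN' : ∑ k, β' k = N := by
      simp only [Pi.add_apply, Finset.sum_add_distrib, Finset.sum_pi_single', Finset.mem_univ,
        if_true] at hN
      simpa using hN
    obtain ⟨q', hq', ht⟩ := ih β' hle hN'
    obtain ⟨q, hq, hr⟩ := E.exists_x_mul_x_sub_mem hji
    obtain ⟨q'', hq'', hr'⟩ := E.exists_x_mul_sub_mem j hq'
    refine ⟨q * q'', by simpa using E.F_mul hq hq'', ?_⟩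
    have hx1 : smon E.x (β' + Pi.single j 1) = E.x j * smon E.x β' := (mul_smon _ _ _ hmin').symm
    have hx2 : smon E.x (β' + Pi.single j 1 + Pi.single i 1)
        = E.x j * smon E.x (β' + Pi.single i 1) := by
      rw [hadd, mul_smon]
      intro k hk
      simp [hmin' k hk, (hk.trans hji).ne]
    rw [map_zero, zero_add] at hr'
    have e1 : E.ψ (β' + Pi.single j 1 + Pi.single i 1)
        = E.ψ (Pi.single j 1) + E.ψ (β' + Pi.single i 1) := by
      simp only [map_add]; abel
    have e2 : E.ψ (β' + Pi.single j 1 + Pi.single i 1)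
        = E.ψ (Pi.single j 1 + Pi.single i 1) + E.ψ β' := by
      simp only [map_add]; abel
    have m1 := hw.tFlt_mul (e1 ▸ hβ) hr' (E.smon_mem_tF (β' + Pi.single i 1))
    have m2 := hw.mul_tFlt (e1 ▸ hβ) (E.x_mem_tF j) ht
    have m3 := hw.tFlt_mul (e2 ▸ hβ) hr (E.smon_mem_tF β')
    rw [← e1] at m1 m2
    rw [← e2] at m3
    have m4 := E.F_mul_tFlt hq (add_mem m1 m2)
    rw [map_zero, zero_add] at m4
    have := add_mem m4 m3
    rw [hx1, hx2]
    convert this using 1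
    noncomm_ring

theorem MulBelow.x_mul_mem {w v : MIdx n} (hw : E.MulBelow w) (i : Fin s)
    (hv : E.o.le (E.ψ (Pi.single i 1) + v) w) {b : B} (hb : b ∈ E.tF v) :
    E.x i * b ∈ E.tF (E.ψ (Pi.single i 1) + v) := by
  have h : E.tF v ≤ (E.tF (E.ψ (Pi.single i 1) + v)).comap (LinearMap.mulLeft K (E.x i)) := by
    refine monSum_le.2 fun γ hγ a ha => ?_
    have hwt : E.ψ (Pi.single i 1) + E.wt γ = E.φ γ.1 + E.ψ (Pi.single i 1) + E.ψ γ.2 := by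
      simp only [wt]; abel
    have hwt' : E.ψ (Pi.single i 1) + E.wt γ = E.φ γ.1 + E.ψ (γ.2 + Pi.single i 1) := by
      simp only [wt, map_add]; abel
    have hle : E.o.le (E.ψ (Pi.single i 1) + E.wt γ) w :=
      E.o.le_trans (E.o.add_left _ hγ) hv
    refine E.tF_mono (E.o.add_left _ hγ) ?_
    obtain ⟨a', ha', hr⟩ := E.exists_x_mul_sub_mem i ha
    obtain ⟨q, hq, ht⟩ := hw.exists_x_mul_smon_sub_mem i γ.2
      (E.o.le_trans (E.o.le_add_left _ (E.φ γ.1)) (hwt' ▸ hle))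
    have m1 := hw.tFlt_mul (hwt ▸ hle) hr (E.smon_mem_tF γ.2)
    have m2 : E.x i * smon E.x γ.2 ∈ E.tF (E.ψ (γ.2 + Pi.single i 1)) := by
      have m3 := E.mul_smon_mem_tF (0, γ.2 + Pi.single i 1) hq
      simp only [wt, map_zero, zero_add] at m3
      simpa using add_mem (E.tFlt_le_tF _ ht) m3
    have m4 := E.F_mul_tF ha' m2
    rw [← hwt] at m1
    rw [← hwt'] at m4
    convert add_mem (E.tFlt_le_tF _ m1) m4 using 1
    simp only [LinearMap.mulLeft_apply]
    noncomm_ring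
  exact h hb

theorem MulBelow.smon_mul_mem {w v : MIdx n} (hw : E.MulBelow w) (β : MIdx s)
    (hv : E.o.le (E.ψ β + v) w) {b : B} (hb : b ∈ E.tF v) :
    smon E.x β * b ∈ E.tF (E.ψ β + v) := by
  induction hN : ∑ k, β k generalizing β with
  | zero =>
    obtain rfl : β = 0 := funext fun j => Finset.sum_eq_zero_iff.1 hN j (Finset.mem_univ j)
    simpa [smon_zero] using hb
  | succ N ih =>
    obtain ⟨i, -, hi⟩ : ∃ i ∈ Finset.univ, β i ≠ 0 :=
      Finset.exists_ne_zero_of_sum_ne_zero (by omega)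
    obtain ⟨j, β', -, rfl, hmin⟩ := MIdx.exists_eq_add_single β i hi
    have hmin' : ∀ k < j, β' k = 0 := fun k hk => by
      have := hmin k hk
      simp only [Pi.add_apply] at this
      omega
    have hN' : ∑ k, β' k = N := by
      simp only [Pi.add_apply, Finset.sum_add_distrib, Finset.sum_pi_single', Finset.mem_univ,
        if_true] at hN
      simpa using hN
    have he : E.ψ (β' + Pi.single j 1) + v = E.ψ (Pi.single j 1) + (E.ψ β' + v) := by
      simp only [map_add]; abel
    rw [he] at hv ⊢
    rw [← mul_smon _ _ _ hmin', mul_assoc]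
    exact hw.x_mul_mem j hv
      (ih β' (E.o.le_trans (E.o.le_add_left _ _) hv) hN')

variable (E)

/-- The family `tF` is multiplicative. -/
theorem tF_mul {u v : MIdx n} {a b : B} (ha : a ∈ E.tF u) (hb : b ∈ E.tF v) :
    a * b ∈ E.tF (u + v) := by
  induction hw : u + v using E.o.wellFounded_lt.induction generalizing u v a b with
  | _ w ih =>
    subst hw
    have hw : E.MulBelow (u + v) := fun u' v' h _ ha _ hb => ih _ h ha hb rfl
    have h : E.tF u ≤ (E.tF (u + v)).comap (LinearMap.mulRight K b) := by
      refine monSum_le.2 fun γ hγ a ha => ?_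
      have hle : E.o.le (E.φ γ.1 + (E.ψ γ.2 + v)) (u + v) := by
        rw [← add_assoc]
        exact E.o.add_right v hγ
      have := E.F_mul_tF ha
        (hw.smon_mul_mem γ.2 (E.o.le_trans (E.o.le_add_left _ _) hle) hb)
      rw [← mul_assoc] at this
      exact E.tF_mono hle this
    exact h ha

theorem exists_mem_tF (b : B) : ∃ w, b ∈ E.tF w := by
  let S : Subalgebra K B :=
    { carrier := {b | ∃ w, b ∈ E.tF w}
      mul_mem' := by
        rintro a b ⟨u, hu⟩ ⟨v, hv⟩
        exact ⟨u + v, E.tF_mul hu hv⟩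
      add_mem' := by
        rintro a b ⟨u, hu⟩ ⟨v, hv⟩
        rcases E.o.le_total u v with h | h
        · exact ⟨v, add_mem (E.tF_mono h hu) hv⟩
        · exact ⟨u, add_mem hu (E.tF_mono h hv)⟩
      algebraMap_mem' := fun k => by
        refine ⟨_, E.F_le_tF 0 ?_⟩
        rw [Algebra.algebraMap_eq_smul_one]
        exact Submodule.smul_mem _ k E.F_one }
  have h : Algebra.adjoin K ((E.A : Set B) ∪ Set.range E.x) ≤ S := by
    refine Algebra.adjoin_le (Set.union_subset (fun a ha => ?_) ?_)
    · obtain ⟨α, hα⟩ := E.F_exhaustive a ha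
      exact ⟨_, E.F_le_tF α hα⟩
    · rintro _ ⟨i, rfl⟩
      exact ⟨_, E.x_mem_tF i⟩
  rw [E.gen] at h
  exact h (Algebra.mem_top (x := b))

theorem eq_zero_or_exists_of_mem_Flt {α : MIdx m} {a : B} (ha : a ∈ E.Flt α) :
    a = 0 ∨ ∃ β, E.o1.lt β α ∧ a ∈ E.F β := by
  let N : Submodule K B :=
    { carrier := {a | a = 0 ∨ ∃ β, E.o1.lt β α ∧ a ∈ E.F β}
      zero_mem' := Or.inl rfl
      add_mem' := by
        rintro a b (rfl | ⟨u, hu, ha⟩) (rfl | ⟨v, hv, hb⟩)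
        · simp
        · exact Or.inr ⟨v, hv, by simpa using hb⟩
        · exact Or.inr ⟨u, hu, by simpa using ha⟩
        · rcases E.o1.le_total u v with h | h
          · exact Or.inr ⟨v, hv, add_mem (E.F_mono h ha) hb⟩
          · exact Or.inr ⟨u, hu, add_mem ha (E.F_mono h hb)⟩
      smul_mem' := by
        rintro k a (rfl | ⟨u, hu, ha⟩)
        · simp
        · exact Or.inr ⟨u, hu, Submodule.smul_mem _ k ha⟩ }
  have h : E.Flt α ≤ N := iSup₂_le fun β hβ b hb => Or.inr ⟨β, hβ, hb⟩
  exact h ha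

/-- Every nonzero element of `A` has an exact filtration degree. -/
theorem exists_mem_F_notMem_Flt {a : B} (ha : a ∈ E.A) (h0 : a ≠ 0) :
    ∃ α, a ∈ E.F α ∧ a ∉ E.Flt α := by
  obtain ⟨α, hα, hmin⟩ := E.o1.wellFounded_lt.has_min {α | a ∈ E.F α} (E.F_exhaustive a ha)
  refine ⟨α, hα, fun h => ?_⟩
  rcases E.eq_zero_or_exists_of_mem_Flt h with h | ⟨β, hβ, hb⟩
  · exact h0 h
  · exact hmin β hb hβ

theorem F_le_Flt {α β : MIdx m} (h : E.o1.lt β α) : E.F β ≤ E.Flt α :=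
  fun _ hb => Submodule.mem_iSup_of_mem β (Submodule.mem_iSup_of_mem h hb)

theorem mapDomain_snd_mem_A {c : (MIdx m × MIdx s) →₀ B} (hc : ∀ γ, c γ ∈ E.F γ.1)
    (β : MIdx s) : c.mapDomain Prod.snd β ∈ E.A := by
  classical
  rw [Finsupp.mapDomain, Finsupp.sum_apply]
  refine sum_mem fun γ _ => ?_
  beta_reduce
  rw [Finsupp.single_apply]
  split_ifs
  · exact E.F_le_A _ (hc γ)
  · exact zero_mem _

theorem sum_mapDomain_snd (c : (MIdx m × MIdx s) →₀ B) :
    ((c.mapDomain Prod.snd).sum fun γ a => a * smon E.x γ)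
      = c.sum fun γ a => a * smon E.x γ.2 :=
  Finsupp.sum_mapDomain_index (by simp) (by simp [add_mul])

/-- The standard monomials generate `B` as a left `A`-module. -/
theorem exists_eq_sum_smon (b : B) : ∃ c : MIdx s →₀ B, (∀ γ, c γ ∈ E.A) ∧
    b = c.sum fun γ a => a * smon E.x γ := by
  obtain ⟨w, hw⟩ := E.exists_mem_tF b
  obtain ⟨c, hc, -, rfl⟩ := exists_finsupp_of_mem_monSum hw
  exact ⟨c.mapDomain Prod.snd, E.mapDomain_snd_mem_A hc, (E.sum_mapDomain_snd c).symm⟩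

theorem wt_injOn_fst (hφ : Function.Injective E.φ) {γ δ : MIdx m × MIdx s}
    (h2 : γ.2 = δ.2) (h : E.wt γ = E.wt δ) : γ = δ := by
  refine Prod.ext (hφ ?_) h2
  simp only [wt, h2] at h
  exact add_right_cancel h

theorem mem_Flt_of_sum_mem_tFlt (hφ : Function.Injective E.φ)
    (hB : ∀ c : MIdx s →₀ B, (∀ γ, c γ ∈ E.A) →
      (c.sum fun γ a => a * smon E.x γ) = 0 → c = 0)
    {α : MIdx n} {c : (MIdx m × MIdx s) →₀ B} (hc : ∀ γ, c γ ∈ E.F γ.1)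
    (hα : ∀ γ ∈ c.support, E.wt γ = α)
    (h : (c.sum fun γ a => a * smon E.x γ.2) ∈ E.tFlt α) (γ : MIdx m × MIdx s) :
    c γ ∈ E.Flt γ.1 := by
  classical
  by_cases hγ : c γ = 0
  · rw [hγ]
    exact zero_mem _
  have hγα := hα γ (Finsupp.mem_support_iff.2 hγ)
  rw [tFlt_eq] at h
  obtain ⟨d, hd, hlt, he⟩ := exists_finsupp_of_mem_monSum h
  have hcd : c.mapDomain Prod.snd = d.mapDomain Prod.snd := by
    rw [← sub_eq_zero]
    refine hB _ (fun β => sub_mem (E.mapDomain_snd_mem_A hc β) (E.mapDomain_snd_mem_A hd β)) ?_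
    rw [Finsupp.sum_sub_index (by simp [sub_mul]), sum_mapDomain_snd, sum_mapDomain_snd, he,
      sub_self]
  have hcγ : c γ = c.mapDomain Prod.snd γ.2 := by
    rw [Finsupp.mapDomain, Finsupp.sum_apply, Finsupp.sum, Finset.sum_eq_single γ]
    · simp
    · intro δ hδ hne
      rw [Finsupp.single_apply, if_neg]
      exact fun h2 => hne (E.wt_injOn_fst hφ h2 ((hα δ hδ).trans hγα.symm))
    · simp
  rw [hcγ, hcd, Finsupp.mapDomain, Finsupp.sum_apply]
  refine sum_mem fun δ hδ => ?_
  beta_reduce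
  rw [Finsupp.single_apply]
  split_ifs with h2
  · refine E.F_le_Flt ?_ (hd δ)
    rw [AdmOrder.lt_iff_not_le]
    intro hle
    have hwt := hlt δ hδ
    rw [AdmOrder.lt_iff_not_le, ← hγα] at hwt
    refine hwt ?_
    simp only [wt, h2]
    exact E.o.add_right _ (E.φ_mono hle)
  · exact zero_mem _

theorem eq_zero_of_sum_smon_eq_zero
    (hG : ∀ (α : MIdx n) (c : (MIdx m × MIdx s) →₀ B),
        (∀ γ, c γ ∈ E.F γ.1) → (∀ γ ∈ c.support, E.wt γ = α) →
        (c.sum fun γ a => a * smon E.x γ.2) ∈ E.tFlt α →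
        ∀ γ : MIdx m × MIdx s, c γ ∈ E.Flt γ.1)
    {c : MIdx s →₀ B} (hc : ∀ γ, c γ ∈ E.A)
    (h : (c.sum fun γ a => a * smon E.x γ) = 0) : c = 0 := by
  classical
  by_contra hne
  have hdeg : ∀ γ, ∃ α, c γ ∈ E.F α ∧ (c γ ≠ 0 → c γ ∉ E.Flt α) := fun γ => by
    by_cases h0 : c γ = 0
    · exact ⟨0, by rw [h0]; exact zero_mem _, fun h => absurd h0 h⟩
    · obtain ⟨α, h1, h2⟩ := E.exists_mem_F_notMem_Flt (hc γ) h0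
      exact ⟨α, h1, fun _ => h2⟩
  choose d hdF hdlt using hdeg
  let e : MIdx s ↪ MIdx m × MIdx s := ⟨fun γ => (d γ, γ), fun _ _ h => congrArg Prod.snd h⟩
  obtain ⟨γ₀, hγ₀, hmax⟩ : ∃ γ₀ ∈ c.support, ∀ γ ∈ c.support,
      E.o.le (E.wt (e γ)) (E.wt (e γ₀)) := by
    have key : ∀ t : Finset (MIdx s), t.Nonempty →
        ∃ γ₀ ∈ t, ∀ γ ∈ t, E.o.le (E.wt (e γ)) (E.wt (e γ₀)) := by
      intro t ht
      induction ht using Finset.Nonempty.cons_induction with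
      | singleton a => exact ⟨a, by simp, by simp [E.o.le_refl]⟩
      | cons a t ha ht ih =>
        obtain ⟨b, hb, hbt⟩ := ih
        rcases E.o.le_total (E.wt (e a)) (E.wt (e b)) with h | h
        · refine ⟨b, by simp [hb], fun γ hγ => ?_⟩
          rcases Finset.mem_cons.1 hγ with rfl | hγ
          exacts [h, hbt γ hγ]
        · refine ⟨a, by simp, fun γ hγ => ?_⟩
          rcases Finset.mem_cons.1 hγ with rfl | hγ
          exacts [E.o.le_refl _, E.o.le_trans (hbt γ hγ) h]
    exact key _ (Finsupp.support_nonempty_iff.2 hne)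
  set w := E.wt (e γ₀) with hw
  let top := (c.filter fun γ => E.wt (e γ) = w).embDomain e
  let low := (c.filter fun γ => ¬ E.wt (e γ) = w).embDomain e
  have hF : ∀ (p : MIdx s → Prop) [DecidablePred p] (γ : MIdx m × MIdx s),
      (c.filter p).embDomain e γ ∈ E.F γ.1 := fun p _ γ => by
    by_cases hγ : γ ∈ Set.range e
    · obtain ⟨δ, rfl⟩ := hγ
      rw [Finsupp.embDomain_apply_self, Finsupp.filter_apply]
      split_ifs
      · exact hdF δ
      · exact zero_mem _
    · rw [Finsupp.embDomain_of_notMem_range _ _ _ hγ]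
      exact zero_mem _
  have hsum : (top.sum fun γ a => a * smon E.x γ.2) +
      (low.sum fun γ a => a * smon E.x γ.2) = 0 := by
    rw [Finsupp.sum_embDomain, Finsupp.sum_embDomain, ← h]
    conv_rhs => rw [← Finsupp.filter_add_filter_not c fun γ => E.wt (e γ) = w]
    rw [Finsupp.sum_add_index' (by simp) (by simp [add_mul])]
    rfl
  have hlow : (low.sum fun γ a => a * smon E.x γ.2) ∈ E.tFlt w := by
    rw [tFlt_eq]
    refine finsupp_sum_mem_monSum (hF _) fun γ hγ => ?_
    rw [Finsupp.support_embDomain] at hγ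
    obtain ⟨δ, hδ, rfl⟩ := Finset.mem_map.1 hγ
    rw [Finsupp.support_filter, Finset.mem_filter] at hδ
    exact ⟨hmax δ hδ.1, hδ.2⟩
  have := hG w top (hF _) (fun γ hγ => by
      rw [Finsupp.support_embDomain] at hγ
      obtain ⟨δ, hδ, rfl⟩ := Finset.mem_map.1 hγ
      rw [Finsupp.support_filter, Finset.mem_filter] at hδ
      exact hδ.2)
    (by rw [eq_neg_of_add_eq_zero_left hsum]; exact neg_mem hlow) (e γ₀)
  rw [Finsupp.embDomain_apply_self, Finsupp.filter_apply_pos (fun γ => E.wt (e γ) = w) _ hw.symm] at this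
  exact hdlt γ₀ (Finsupp.mem_support_iff.1 hγ₀) this

end BoundedExt

/-- **Theorem (bases).** Let `A ⊆ B` be a `(φ,ψ)`-bounded extension with `φ` injective.
Then `B` is a free left `A`-module with basis the standard monomials `{x^α : α ∈ ℕ^s}`
if and only if `f : G(A) → G(B)` is injective and `G(B)` is a free left `G(A)`-module with
basis `{y^α : α ∈ ℕ^s}`.  Freeness of `G(B)` over `G(A)` is expressed at the filtered
level: spanning means `F̃_α(B) = (Σ_{wt γ = α} F_{γ₁}(A)x^{γ₂}) + F̃_{≺α}(B)` for all `α`,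
and independence means that any homogeneous combination `Σ_{wt γ = α} a_{γ₁}x^{γ₂}`
(`a_{γ₁} ∈ F_{γ₁}(A)`) lying in `F̃_{≺α}(B)` has all coefficient classes zero, i.e.
`a_{γ₁} ∈ F_{≺γ₁}(A)`. -/
theorem boundedExt_free_basis_iff {K : Type*} [CommRing K] {B : Type*} [Ring B]
    [Algebra K B] {m s n : ℕ} (E : BoundedExt K B m s n)
    (hφ : Function.Injective E.φ) :
    ((∀ b : B, ∃ c : MIdx s →₀ B, (∀ γ, c γ ∈ E.A) ∧
        b = c.sum fun γ a => a * smon E.x γ) ∧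
      (∀ c : MIdx s →₀ B, (∀ γ, c γ ∈ E.A) →
        (c.sum fun γ a => a * smon E.x γ) = 0 → c = 0)) ↔
    ((∀ α : MIdx m, ∀ a ∈ E.F α, a ∈ E.tFlt (E.φ α) → a ∈ E.Flt α) ∧
      (∀ α : MIdx n,
        E.tF α = monSum K B E.F E.x (fun γ => E.wt γ = α) ⊔ E.tFlt α) ∧
      (∀ (α : MIdx n) (c : (MIdx m × MIdx s) →₀ B),
        (∀ γ, c γ ∈ E.F γ.1) → (∀ γ ∈ c.support, E.wt γ = α) →
        (c.sum fun γ a => a * smon E.x γ.2) ∈ E.tFlt α →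
        ∀ γ : MIdx m × MIdx s, c γ ∈ E.Flt γ.1)) := by
  refine ⟨fun ⟨_, hB⟩ => ?_, fun ⟨_, _, hG⟩ =>
    ⟨E.exists_eq_sum_smon, fun c hc h => E.eq_zero_of_sum_smon_eq_zero hG hc h⟩⟩
  refine ⟨fun α a ha h => ?_, E.tF_eq_sup,
    fun α c hc hα h => E.mem_Flt_of_sum_mem_tFlt hφ hB hc hα h⟩
  classical
  have := E.mem_Flt_of_sum_mem_tFlt hφ hB (α := E.φ α)
    (c := Finsupp.single ((α, 0) : MIdx m × MIdx s) a) (fun γ => ?_) (fun γ hγ => ?_) ?_ (α, 0)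
  · simpa using this
  · rw [Finsupp.single_apply]
    split_ifs with hγ
    · exact hγ ▸ ha
    · exact zero_mem _
  · rw [Finset.mem_singleton.1 (Finsupp.support_single_subset hγ)]
    simp [BoundedExt.wt]
  · simpa [smon_zero] using h
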